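/- τ-quantization of monomials, second form (dimension N = 1): for all natural numbers m, n, every real number τ, and all Schwartz functions ψ, φ on ℝ, ∫_{ℝ²} x^m p^n W_τ(ψ,φ)(x,p) dx dp = Σ_{k=0}^{n} C(n,k) (1−τ)^k τ^{n−k} ∫_ℝ D^k(y ↦ y^m · D^{n−k}ψ(y))(x) · conj(φ(x)) dx, where D denotes the operator −iħ d/dx and C(n,k) is the binomial coefficient. -/

import Mathlib

open MeasureTheory Complex

noncomputable section

/-- The one-dimensional `τ`-Wigner transform
`W_τ(ψ,φ)(x,p) = (2πħ)^{-1} ∫ e^{-i p y/ħ} ψ(x+τy) conj(φ(x-(1-τ)y)) dy`. -/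
def Wig1 (hbar τ : ℝ) (ψ φ : ℝ → ℂ) (z : ℝ × ℝ) : ℂ :=
  ((2 * Real.pi * hbar : ℝ) : ℂ)⁻¹ *
    ∫ y : ℝ, Complex.exp (-Complex.I * (z.2 : ℂ) * (y : ℂ) / (hbar : ℂ)) *
      ψ (z.1 + τ * y) * (starRingEnd ℂ) (φ (z.1 - (1 - τ) * y))

/-- The momentum operator `D = -iħ d/dx`. -/
def Dop (hbar : ℝ) (f : ℝ → ℂ) : ℝ → ℂ :=
  fun x => -Complex.I * (hbar : ℂ) * deriv f x

/-- Multiplication by the coordinate on Schwartz functions. -/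
def WX (f : SchwartzMap ℝ ℂ) : SchwartzMap ℝ ℂ := SchwartzMap.smulLeftCLM ℂ Complex.ofReal f

/-- The momentum operator on Schwartz functions. -/
def WD (hbar : ℝ) (f : SchwartzMap ℝ ℂ) : SchwartzMap ℝ ℂ :=
  (-Complex.I * (hbar : ℂ)) • SchwartzMap.derivCLM ℂ ℂ f

lemma WX_apply (f : SchwartzMap ℝ ℂ) (x : ℝ) : WX f x = (x : ℂ) * f x := by
  unfold WX
  rw [SchwartzMap.smulLeftCLM_apply_apply (g := Complex.ofReal) Complex.ofRealCLM.hasTemperateGrowth]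
  rfl

lemma WD_apply (hbar : ℝ) (f : SchwartzMap ℝ ℂ) (x : ℝ) :
    WD hbar f x = -Complex.I * (hbar : ℂ) * deriv f x := by
  simp [WD]

lemma WX_iter (m : ℕ) (f : SchwartzMap ℝ ℂ) (x : ℝ) : (WX^[m] f) x = (x : ℂ) ^ m * f x := by
  induction m with
  | zero => simp
  | succ m ih => rw [Function.iterate_succ_apply', WX_apply, ih]; ring

lemma WD_iter (hbar : ℝ) (k : ℕ) (f : SchwartzMap ℝ ℂ) :
    ⇑((WD hbar)^[k] f) = (Dop hbar)^[k] ⇑f := by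
  induction k with
  | zero => simp
  | succ k ih =>
    rw [Function.iterate_succ_apply', Function.iterate_succ_apply', ← ih]
    ext x
    rw [WD_apply]; rfl

lemma schwartz_bdd (f : SchwartzMap ℝ ℂ) : ∃ C, 0 ≤ C ∧ ∀ x, ‖f x‖ ≤ C :=
  ⟨_, apply_nonneg _ _, fun x => SchwartzMap.norm_le_seminorm ℂ f x⟩

/-- The integrand. -/
def FF (τ : ℝ) (ψ φ : ℝ → ℂ) (x y : ℝ) : ℂ :=
  ψ (x + τ * y) * (starRingEnd ℂ) (φ (x - (1 - τ) * y))

lemma FF_cont (τ : ℝ) (ψ φ : SchwartzMap ℝ ℂ) :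
    Continuous (fun z : ℝ × ℝ => FF τ ψ φ z.1 z.2) := by
  unfold FF
  have h1 := ψ.continuous
  have h2 := φ.continuous
  fun_prop

lemma comp_affine (f : SchwartzMap ℝ ℂ) (t : ℝ) (ht : t ≠ 0) (x : ℝ) :
    Integrable (fun y => f (x + t * y)) ∧
      ∫ y, ‖f (x + t * y)‖ = |t⁻¹| * ∫ y, ‖f y‖ := by
  constructor
  · exact (f.integrable.comp_add_left x).comp_mul_left' ht
  · have h1 := Measure.integral_comp_mul_left (fun y => ‖f (x + y)‖) t
    rw [h1, integral_add_left_eq_self (fun y => ‖f y‖) x]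
    rfl

lemma FF_int (τ : ℝ) (ψ φ : SchwartzMap ℝ ℂ) :
    ∃ C, 0 ≤ C ∧ ∀ x, Integrable (FF τ ψ φ x) ∧ ∫ y, ‖FF τ ψ φ x y‖ ≤ C := by
  obtain ⟨A, hA, hψ⟩ := schwartz_bdd ψ
  obtain ⟨B, hB, hφ⟩ := schwartz_bdd φ
  have hc : ∀ x, Continuous (FF τ ψ φ x) := fun x =>
    (FF_cont τ ψ φ).comp (Continuous.prodMk_right x)
  by_cases hτ : τ = 0
  · refine ⟨A * (|(-(1 - τ))⁻¹| * ∫ y, ‖φ y‖),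
      mul_nonneg hA (mul_nonneg (abs_nonneg _) (integral_nonneg fun _ => norm_nonneg _)), fun x => ?_⟩
    obtain ⟨h1, h2⟩ := comp_affine φ (-(1 - τ)) (by simp [hτ]) x
    have hb : ∀ y, ‖FF τ ψ φ x y‖ ≤ A * ‖φ (x + -(1 - τ) * y)‖ := by
      intro y
      rw [FF, norm_mul, RCLike.norm_conj, show x - (1 - τ) * y = x + -(1 - τ) * y by ring]
      exact mul_le_mul_of_nonneg_right (hψ _) (norm_nonneg _)
    have hi : Integrable (FF τ ψ φ x) :=
      (h1.norm.const_mul A).mono' (hc x).aestronglyMeasurable (Filter.Eventually.of_forall hb)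
    refine ⟨hi, ?_⟩
    rw [← h2, ← integral_const_mul]
    exact integral_mono hi.norm (h1.norm.const_mul A) hb
  · refine ⟨B * (|τ⁻¹| * ∫ y, ‖ψ y‖),
      mul_nonneg hB (mul_nonneg (abs_nonneg _) (integral_nonneg fun _ => norm_nonneg _)), fun x => ?_⟩
    obtain ⟨h1, h2⟩ := comp_affine ψ τ hτ x
    have hb : ∀ y, ‖FF τ ψ φ x y‖ ≤ B * ‖ψ (x + τ * y)‖ := by
      intro y
      rw [FF, norm_mul, RCLike.norm_conj, mul_comm]
      exact mul_le_mul_of_nonneg_right (hφ _) (norm_nonneg _)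
    have hi : Integrable (FF τ ψ φ x) :=
      (h1.norm.const_mul B).mono' (hc x).aestronglyMeasurable (Filter.Eventually.of_forall hb)
    refine ⟨hi, ?_⟩
    rw [← h2, ← integral_const_mul]
    exact integral_mono hi.norm (h1.norm.const_mul B) hb

/-- The phase factor. -/
def EE (hbar p y : ℝ) : ℂ := Complex.exp (-Complex.I * (p : ℂ) * (y : ℂ) / (hbar : ℂ))

lemma EE_norm (hbar p y : ℝ) : ‖EE hbar p y‖ = 1 := by
  have : -Complex.I * (p : ℂ) * (y : ℂ) / (hbar : ℂ) = ((-(p * y / hbar) : ℝ) : ℂ) * Complex.I := by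
    push_cast; ring
  rw [EE, this, Complex.norm_exp_ofReal_mul_I]

lemma EE_cont (hbar : ℝ) : Continuous (fun z : ℝ × ℝ => EE hbar z.1 z.2) := by
  unfold EE
  fun_prop

lemma Wig1_eq (hbar τ : ℝ) (ψ φ : ℝ → ℂ) (x p : ℝ) :
    Wig1 hbar τ ψ φ (x, p) =
      ((2 * Real.pi * hbar : ℝ) : ℂ)⁻¹ * ∫ y : ℝ, EE hbar p y * FF τ ψ φ x y := by
  simp only [Wig1, EE, FF, mul_assoc]

lemma EF_int (hbar τ : ℝ) (ψ φ : SchwartzMap ℝ ℂ) (x p : ℝ) :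
    Integrable (fun y => EE hbar p y * FF τ ψ φ x y) := by
  obtain ⟨C, -, h⟩ := FF_int τ ψ φ
  refine (h x).1.bdd_mul (c := 1) ?_ ?_
  · exact ((EE_cont hbar).comp (Continuous.prodMk_right p)).aestronglyMeasurable
  · exact Filter.Eventually.of_forall fun y => (EE_norm hbar p y).le

lemma Wig_bdd (hbar τ : ℝ) (ψ φ : SchwartzMap ℝ ℂ) :
    ∃ C, ∀ x p, ‖Wig1 hbar τ ψ φ (x, p)‖ ≤ C := by
  obtain ⟨C, hC, h⟩ := FF_int τ ψ φ
  refine ⟨‖((2 * Real.pi * hbar : ℝ) : ℂ)⁻¹‖ * C, fun x p => ?_⟩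
  rw [Wig1_eq, norm_mul]
  refine mul_le_mul_of_nonneg_left ?_ (norm_nonneg _)
  refine (norm_integral_le_integral_norm _).trans ?_
  simpa only [norm_mul, EE_norm, one_mul] using (h x).2

lemma Wig_x (hbar τ : ℝ) (ψ φ : SchwartzMap ℝ ℂ) (x p : ℝ) :
    (x : ℂ) * Wig1 hbar τ ψ φ (x, p) =
      ((1 - τ : ℝ) : ℂ) * Wig1 hbar τ (WX ψ) φ (x, p) + (τ : ℂ) * Wig1 hbar τ ψ (WX φ) (x, p) := by
  simp only [Wig1_eq]
  have h1 := EF_int hbar τ (WX ψ) φ x p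
  have h2 := EF_int hbar τ ψ (WX φ) x p
  have : ∫ y : ℝ, (x : ℂ) * (EE hbar p y * FF τ ψ φ x y) =
      ∫ y : ℝ, (((1 - τ : ℝ) : ℂ) * (EE hbar p y * FF τ (WX ψ) φ x y)
        + (τ : ℂ) * (EE hbar p y * FF τ ψ (WX φ) x y)) := by
    congr 1
    ext y
    simp only [FF, WX_apply, map_mul, Complex.conj_ofReal]
    push_cast
    ring
  rw [integral_const_mul, integral_add (h1.const_mul _) (h2.const_mul _), integral_const_mul,
    integral_const_mul] at this
  linear_combination ((2 * Real.pi * hbar : ℝ) : ℂ)⁻¹ * this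

lemma FF_deriv (hbar τ : ℝ) (hh : hbar ≠ 0) (ψ φ : SchwartzMap ℝ ℂ) (x y : ℝ) :
    HasDerivAt (FF τ ψ φ x) ((Complex.I / hbar) * ((τ : ℂ) * FF τ (WD hbar ψ) φ x y
      + ((1 - τ : ℝ) : ℂ) * FF τ ψ (WD hbar φ) x y)) y := by
  have ha : HasDerivAt (fun y : ℝ => x + τ * y) τ y := by
    simpa using ((hasDerivAt_id y).const_mul τ).const_add x
  have hb : HasDerivAt (fun y : ℝ => x - (1 - τ) * y) (-(1 - τ)) y := by
    simpa using ((hasDerivAt_id y).const_mul (1 - τ)).const_sub x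
  have h1 := (ψ.hasDerivAt (x + τ * y)).scomp y ha
  have h2 := ((φ.hasDerivAt (x - (1 - τ) * y)).scomp y hb).star
  have h3 := h1.mul h2
  have hh' : (hbar : ℂ) ≠ 0 := by exact_mod_cast hh
  refine h3.congr_deriv ?_
  have hst : ∀ c : ℂ, star (-(1 - τ) • c) = -(1 - (τ : ℂ)) * star c := by
    intro c
    rw [star_smul, star_trivial, Complex.real_smul]
    push_cast
    ring
  have hs : star (Complex.I) = -Complex.I := Complex.conj_I
  have hr : star (hbar : ℂ) = hbar := Complex.conj_ofReal _
  rw [hst]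
  simp only [FF, WD_apply, Function.comp, starRingEnd_apply, Complex.real_smul,
    star_mul, star_neg, hs, hr]
  generalize star (φ (x - (1 - τ) * y)) = A
  generalize star (deriv φ (x - (1 - τ) * y)) = B
  generalize ψ (x + τ * y) = C
  generalize deriv ψ (x + τ * y) = D
  have hI := Complex.I_sq
  have hq : (hbar : ℂ)⁻¹ * hbar = 1 := inv_mul_cancel₀ hh'
  push_cast
  rw [div_eq_mul_inv]
  linear_combination ((τ : ℂ) * D * A - (1 - (τ : ℂ)) * C * B) * (hI + Complex.I ^ 2 * hq)

lemma EE_deriv (hbar p y : ℝ) :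
    HasDerivAt (EE hbar p) (EE hbar p y * (-Complex.I * p / hbar)) y := by
  have h : HasDerivAt (fun y : ℝ => -Complex.I * (p : ℂ) * (y : ℂ) / (hbar : ℂ))
      (-Complex.I * p / hbar) y := by
    have := ((Complex.ofRealCLM.hasDerivAt (x := y)).const_mul (-Complex.I * (p : ℂ))).div_const
      (hbar : ℂ)
    simpa using this
  exact h.cexp

lemma Wig_p (hbar τ : ℝ) (hh : hbar ≠ 0) (ψ φ : SchwartzMap ℝ ℂ) (x p : ℝ) :
    (p : ℂ) * Wig1 hbar τ ψ φ (x, p) =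
      (τ : ℂ) * Wig1 hbar τ (WD hbar ψ) φ (x, p)
        + ((1 - τ : ℝ) : ℂ) * Wig1 hbar τ ψ (WD hbar φ) (x, p) := by
  simp only [Wig1_eq]
  have h0 := EF_int hbar τ ψ φ x p
  have h1 := EF_int hbar τ (WD hbar ψ) φ x p
  have h2 := EF_int hbar τ ψ (WD hbar φ) x p
  have e1 : ∀ y, EE hbar p y * ((Complex.I / hbar) * ((τ : ℂ) * FF τ (WD hbar ψ) φ x y
      + ((1 - τ : ℝ) : ℂ) * FF τ ψ (WD hbar φ) x y)) =
      (Complex.I / hbar * τ) * (EE hbar p y * FF τ (WD hbar ψ) φ x y) +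
      (Complex.I / hbar * ((1 - τ : ℝ) : ℂ)) * (EE hbar p y * FF τ ψ (WD hbar φ) x y) := by
    intro y; ring
  have e2 : ∀ y, EE hbar p y * (-Complex.I * p / hbar) * FF τ ψ φ x y =
      (-Complex.I * p / hbar) * (EE hbar p y * FF τ ψ φ x y) := by
    intro y; ring
  have key := integral_mul_deriv_eq_deriv_mul_of_integrable (u := EE hbar p) (v := FF τ ψ φ x)
    (fun y _ => EE_deriv hbar p y) (fun y _ => FF_deriv hbar τ hh ψ φ x y)
    (((h1.const_mul _).add (h2.const_mul _)).congr
      (Filter.Eventually.of_forall fun y => (e1 y).symm))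
    ((h0.const_mul _).congr (Filter.Eventually.of_forall fun y => (e2 y).symm)) h0
  simp only [e1, e2] at key
  rw [integral_add (h1.const_mul _) (h2.const_mul _), integral_const_mul,
    integral_const_mul, integral_const_mul] at key
  have hh' : (hbar : ℂ) ≠ 0 := by exact_mod_cast hh
  have key2 : (p : ℂ) * ∫ y : ℝ, EE hbar p y * FF τ ψ φ x y =
      τ * (∫ y : ℝ, EE hbar p y * FF τ (WD hbar ψ) φ x y)
       + ((1 - τ : ℝ) : ℂ) * ∫ y : ℝ, EE hbar p y * FF τ ψ (WD hbar φ) x y := by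
    have hI : Complex.I / hbar ≠ 0 := div_ne_zero Complex.I_ne_zero hh'
    apply mul_left_cancel₀ hI
    linear_combination -key
  linear_combination ((2 * Real.pi * hbar : ℝ) : ℂ)⁻¹ * key2

lemma Wig_bdd_mono (hbar τ : ℝ) (hh : hbar ≠ 0) (i j : ℕ) : ∀ (ψ φ : SchwartzMap ℝ ℂ),
    ∃ C, ∀ x p : ℝ, ‖(x : ℂ) ^ i * (p : ℂ) ^ j * Wig1 hbar τ ψ φ (x, p)‖ ≤ C := by
  induction i with
  | zero =>
    induction j with
    | zero => simpa using Wig_bdd hbar τ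
    | succ j ih =>
      intro ψ φ
      obtain ⟨A, hA⟩ := ih (WD hbar ψ) φ
      obtain ⟨B, hB⟩ := ih ψ (WD hbar φ)
      refine ⟨‖(τ : ℂ)‖ * A + ‖((1 - τ : ℝ) : ℂ)‖ * B, fun x p => ?_⟩
      have e : (x : ℂ) ^ 0 * (p : ℂ) ^ (j + 1) * Wig1 hbar τ ψ φ (x, p) =
        (τ : ℂ) * ((x : ℂ) ^ 0 * (p : ℂ) ^ j * Wig1 hbar τ (WD hbar ψ) φ (x, p))
        + ((1 - τ : ℝ) : ℂ) * ((x : ℂ) ^ 0 * (p : ℂ) ^ j * Wig1 hbar τ ψ (WD hbar φ) (x, p)) := by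
        linear_combination (x : ℂ) ^ 0 * (p : ℂ) ^ j * Wig_p hbar τ hh ψ φ x p
      rw [e]
      refine (norm_add_le _ _).trans ?_
      rw [norm_mul, norm_mul (((1 - τ : ℝ) : ℂ))]
      gcongr
      · exact hA x p
      · exact hB x p
  | succ i ih =>
    intro ψ φ
    obtain ⟨A, hA⟩ := ih (WX ψ) φ
    obtain ⟨B, hB⟩ := ih ψ (WX φ)
    refine ⟨‖((1 - τ : ℝ) : ℂ)‖ * A + ‖(τ : ℂ)‖ * B, fun x p => ?_⟩
    have e : (x : ℂ) ^ (i + 1) * (p : ℂ) ^ j * Wig1 hbar τ ψ φ (x, p) =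
      ((1 - τ : ℝ) : ℂ) * ((x : ℂ) ^ i * (p : ℂ) ^ j * Wig1 hbar τ (WX ψ) φ (x, p))
      + (τ : ℂ) * ((x : ℂ) ^ i * (p : ℂ) ^ j * Wig1 hbar τ ψ (WX φ) (x, p)) := by
      linear_combination (x : ℂ) ^ i * (p : ℂ) ^ j * Wig_x hbar τ ψ φ x p
    rw [e]
    refine (norm_add_le _ _).trans ?_
    rw [norm_mul, norm_mul (τ : ℂ)]
    gcongr
    · exact hA x p
    · exact hB x p

lemma Wig_meas (hbar τ : ℝ) (ψ φ : SchwartzMap ℝ ℂ) :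
    StronglyMeasurable (Wig1 hbar τ ψ φ) := by
  have h : Continuous (fun q : (ℝ × ℝ) × ℝ => EE hbar q.1.2 q.2 * FF τ ψ φ q.1.1 q.2) := by
    have h1 := (EE_cont hbar).comp (f := fun q : (ℝ × ℝ) × ℝ => (q.1.2, q.2)) (by fun_prop)
    have h2 := (FF_cont τ ψ φ).comp (f := fun q : (ℝ × ℝ) × ℝ => (q.1.1, q.2)) (by fun_prop)
    exact h1.mul h2
  have h3 := (h.stronglyMeasurable.integral_prod_right' (ν := volume)).const_mul
    (((2 * Real.pi * hbar : ℝ) : ℂ)⁻¹)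
  convert h3 using 1
  ext ⟨x, p⟩
  rw [Wig1_eq]

lemma Wig_dom (hbar τ : ℝ) (hh : hbar ≠ 0) (i j : ℕ) (ψ φ : SchwartzMap ℝ ℂ) :
    ∃ C, ∀ x p : ℝ, ‖(x : ℂ) ^ i * (p : ℂ) ^ j * Wig1 hbar τ ψ φ (x, p)‖ ≤
      C * ((1 + x ^ 2)⁻¹ * (1 + p ^ 2)⁻¹) := by
  obtain ⟨A, hA⟩ := Wig_bdd_mono hbar τ hh i j ψ φ
  obtain ⟨B, hB⟩ := Wig_bdd_mono hbar τ hh (i + 2) j ψ φ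
  obtain ⟨C, hC⟩ := Wig_bdd_mono hbar τ hh i (j + 2) ψ φ
  obtain ⟨D, hD⟩ := Wig_bdd_mono hbar τ hh (i + 2) (j + 2) ψ φ
  refine ⟨A + B + C + D, fun x p => ?_⟩
  have a := hA x p
  have b := hB x p
  have c := hC x p
  have d := hD x p
  simp only [norm_mul, norm_pow, Complex.norm_real, Real.norm_eq_abs, pow_add, sq_abs] at a b c d ⊢
  rw [← mul_inv, ← div_eq_mul_inv, le_div_iff₀ (by positivity)]
  linarith

lemma Wig_int (hbar τ : ℝ) (hh : hbar ≠ 0) (i j : ℕ) (ψ φ : SchwartzMap ℝ ℂ) :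
    Integrable (fun z : ℝ × ℝ => (z.1 : ℂ) ^ i * (z.2 : ℂ) ^ j * Wig1 hbar τ ψ φ z) := by
  obtain ⟨C, hC⟩ := Wig_dom hbar τ hh i j ψ φ
  have h := (integrable_inv_one_add_sq.mul_prod integrable_inv_one_add_sq).const_mul C
  refine Integrable.mono' h ?_ (Filter.Eventually.of_forall fun z => hC z.1 z.2)
  refine AEStronglyMeasurable.mul ?_ (Wig_meas hbar τ ψ φ).aestronglyMeasurable
  exact Continuous.aestronglyMeasurable (by fun_prop)

lemma Wig_marg (hbar τ : ℝ) (hh : 0 < hbar) (ψ φ : SchwartzMap ℝ ℂ) (x : ℝ) :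
    ∫ p, Wig1 hbar τ ψ φ (x, p) = ψ x * (starRingEnd ℂ) (φ x) := by
  obtain ⟨C, hC⟩ := Wig_dom hbar τ hh.ne' 0 0 ψ φ
  have hpi := Real.pi_pos
  set a : ℝ := 2 * Real.pi * hbar with ha
  have ha0 : 0 < a := by positivity
  have hWi : Integrable (fun p => Wig1 hbar τ ψ φ (x, p)) := by
    refine Integrable.mono' ((integrable_inv_one_add_sq.const_mul ((1 + x ^ 2)⁻¹)).const_mul C)
      ((Wig_meas hbar τ ψ φ).comp_measurable measurable_prodMk_left).aestronglyMeasurable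
      (Filter.Eventually.of_forall fun p => by simpa using hC x p)
  have hF : ∀ w : ℝ, FourierTransform.fourier (FF τ ψ φ x) w
      = (a : ℂ) * Wig1 hbar τ ψ φ (x, a * w) := by
    intro w
    have hac : (a : ℂ) ≠ 0 := by exact_mod_cast ha0.ne'
    rw [Wig1_eq, ← ha, mul_inv_cancel_left₀ hac, Real.fourier_real_eq_integral_exp_smul]
    congr 1
    ext y
    rw [smul_eq_mul, EE]
    congr 2
    have hh' : (hbar : ℂ) ≠ 0 := by exact_mod_cast hh.ne'
    rw [ha]
    push_cast
    field_simp
  have hFi : Integrable (FourierTransform.fourier (FF τ ψ φ x)) := by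
    have : FourierTransform.fourier (FF τ ψ φ x) =
      fun w => (a : ℂ) * Wig1 hbar τ ψ φ (x, a * w) := funext hF
    rw [this]
    exact (hWi.comp_mul_left' ha0.ne').const_mul _
  obtain ⟨_, _, hfi⟩ := FF_int τ ψ φ
  have hc : Continuous (FF τ ψ φ x) := (FF_cont τ ψ φ).comp (Continuous.prodMk_right x)
  have inv := (hfi x).1.fourierInv_fourier_eq hFi (v := 0) hc.continuousAt
  rw [Real.fourierInv_eq'] at inv
  simp only [inner_zero_right, mul_zero, Complex.ofReal_zero, zero_mul, Complex.exp_zero,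
    one_smul, hF] at inv
  rw [integral_const_mul, Measure.integral_comp_mul_left (fun p => Wig1 hbar τ ψ φ (x, p)) a,
    abs_of_pos (inv_pos.2 ha0), Complex.real_smul, Complex.ofReal_inv,
    mul_inv_cancel_left₀ (by exact_mod_cast ha0.ne')] at inv
  rw [inv]
  simp [FF]

lemma Wig_total (hbar τ : ℝ) (hh : 0 < hbar) (ψ φ : SchwartzMap ℝ ℂ) :
    ∫ z, Wig1 hbar τ ψ φ z = ∫ x, ψ x * (starRingEnd ℂ) (φ x) := by
  have h := Wig_int hbar τ hh.ne' 0 0 ψ φ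
  simp only [pow_zero, one_mul] at h
  rw [Measure.volume_eq_prod] at h ⊢
  rw [integral_prod _ h]
  simp only [Wig_marg hbar τ hh]

lemma Wig_xm (hbar τ : ℝ) (hh : 0 < hbar) (m : ℕ) : ∀ (ψ φ : SchwartzMap ℝ ℂ),
    ∫ z : ℝ × ℝ, (z.1 : ℂ) ^ m * Wig1 hbar τ ψ φ z
      = ∫ x : ℝ, (x : ℂ) ^ m * ψ x * (starRingEnd ℂ) (φ x) := by
  induction m with
  | zero => intro ψ φ; simpa using Wig_total hbar τ hh ψ φ
  | succ m ih =>
    intro ψ φ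
    have h1 := Wig_int hbar τ hh.ne' m 0 (WX ψ) φ
    have h2 := Wig_int hbar τ hh.ne' m 0 ψ (WX φ)
    simp only [pow_zero, mul_one] at h1 h2
    have e : ∀ z : ℝ × ℝ, (z.1 : ℂ) ^ (m + 1) * Wig1 hbar τ ψ φ z =
        ((1 - τ : ℝ) : ℂ) * ((z.1 : ℂ) ^ m * Wig1 hbar τ (WX ψ) φ z)
        + (τ : ℂ) * ((z.1 : ℂ) ^ m * Wig1 hbar τ ψ (WX φ) z) := by
      rintro ⟨x, p⟩
      linear_combination (x : ℂ) ^ m * Wig_x hbar τ ψ φ x p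
    simp only [e]
    rw [integral_add (h1.const_mul _) (h2.const_mul _), integral_const_mul,
      integral_const_mul, ih, ih]
    have e1 : ∀ x : ℝ, (x : ℂ) ^ m * (WX ψ) x * (starRingEnd ℂ) (φ x) =
        (x : ℂ) ^ (m + 1) * ψ x * (starRingEnd ℂ) (φ x) := by
      intro x; rw [WX_apply]; ring
    have e2 : ∀ x : ℝ, (x : ℂ) ^ m * ψ x * (starRingEnd ℂ) ((WX φ) x) =
        (x : ℂ) ^ (m + 1) * ψ x * (starRingEnd ℂ) (φ x) := by
      intro x; rw [WX_apply, map_mul, Complex.conj_ofReal]; ring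
    simp only [e1, e2]
    push_cast
    ring

lemma WD_symm (hbar : ℝ) (f g : SchwartzMap ℝ ℂ) :
    ∫ x, f x * (starRingEnd ℂ) (WD hbar g x) = ∫ x, WD hbar f x * (starRingEnd ℂ) (g x) := by
  let L : ℂ →L[ℝ] ℂ →L[ℝ] ℂ :=
    ((ContinuousLinearMap.mul ℝ ℂ).flip.comp (Complex.conjCLE : ℂ →L[ℝ] ℂ)).flip
  have hL : ∀ a b, L a b = a * (starRingEnd ℂ) b := fun a b => rfl
  have h := SchwartzMap.integral_bilinear_deriv_right_eq_neg_left f g L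
  simp only [hL] at h
  have e1 : ∀ x, f x * (starRingEnd ℂ) (WD hbar g x) =
      (Complex.I * hbar) * (f x * (starRingEnd ℂ) (deriv g x)) := by
    intro x
    rw [WD_apply]
    simp only [map_mul, map_neg, Complex.conj_I, Complex.conj_ofReal]
    ring
  have e2 : ∀ x, WD hbar f x * (starRingEnd ℂ) (g x) =
      (-Complex.I * hbar) * (deriv f x * (starRingEnd ℂ) (g x)) := by
    intro x
    rw [WD_apply]
    ring
  simp only [e1, e2]
  rw [integral_const_mul, integral_const_mul, h]
  ring

lemma WD_symm_iter (hbar : ℝ) (k : ℕ) : ∀ (f g : SchwartzMap ℝ ℂ),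
    ∫ x, f x * (starRingEnd ℂ) ((WD hbar)^[k] g x)
      = ∫ x, (WD hbar)^[k] f x * (starRingEnd ℂ) (g x) := by
  induction k with
  | zero => intro f g; rfl
  | succ k ih =>
    intro f g
    rw [Function.iterate_succ_apply', WD_symm, ih, Function.iterate_succ_apply]

lemma binom_rec (s t : ℂ) (u : ℕ → ℕ → ℕ → ℂ)
    (h : ∀ n a b, u (n + 1) a b = t * u n (a + 1) b + s * u n a (b + 1)) (n : ℕ) :
    ∀ a b, u n a b = ∑ k ∈ Finset.range (n + 1),
      (n.choose k : ℂ) * s ^ k * t ^ (n - k) * u 0 (a + (n - k)) (b + k) := by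
  have key : ∀ a b, u n a b = ∑ ij ∈ Finset.HasAntidiagonal.antidiagonal n,
      (n.choose ij.1 : ℂ) * (s ^ ij.1 * t ^ ij.2 * u 0 (a + ij.2) (b + ij.1)) := by
    induction n with
    | zero => intro a b; simp
    | succ n ih =>
      intro a b
      rw [Finset.sum_antidiagonal_choose_succ_mul
        (fun i j => s ^ i * t ^ j * u 0 (a + j) (b + i)), h, ih, ih, Finset.mul_sum, Finset.mul_sum]
      congr 1
      · refine Finset.sum_congr rfl fun ij _ => ?_
        rw [show a + 1 + ij.2 = a + (ij.2 + 1) by ring]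
        ring
      · refine Finset.sum_congr rfl fun ij hij => ?_
        rw [show b + 1 + ij.1 = b + (ij.1 + 1) by ring,
          Nat.choose_symm_of_eq_add (Finset.HasAntidiagonal.mem_antidiagonal.1 hij).symm]
        ring
  intro a b
  rw [key, Finset.Nat.sum_antidiagonal_eq_sum_range_succ
    (fun i j => (n.choose i : ℂ) * (s ^ i * t ^ j * u 0 (a + j) (b + i)))]
  exact Finset.sum_congr rfl fun k _ => by ring

/-- `τ`-quantization of monomials, second form:
`Op_τ(x^m p^n) = Σ_{k=0}^n C(n,k) (1−τ)^k τ^{n−k} p̂^k x̂^m p̂^{n−k}`,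
expressed through the pairing with the `τ`-Wigner transform. -/
theorem stmt_4 (hbar : ℝ) (hhbar : 0 < hbar) (m n : ℕ) (τ : ℝ)
    (ψ φ : SchwartzMap ℝ ℂ) :
    ∫ z : ℝ × ℝ, (z.1 : ℂ) ^ m * (z.2 : ℂ) ^ n * Wig1 hbar τ (⇑ψ) (⇑φ) z
      = ∑ k ∈ Finset.range (n + 1),
          (n.choose k : ℂ) * ((1 - τ : ℝ) : ℂ) ^ k * (τ : ℂ) ^ (n - k) *
            ∫ x : ℝ,
              ((Dop hbar)^[k] (fun y => (y : ℂ) ^ m * (Dop hbar)^[n - k] (⇑ψ) y)) x *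
              (starRingEnd ℂ) (φ x) := by
  have hrec := binom_rec ((1 - τ : ℝ) : ℂ) (τ : ℂ)
    (fun n a b => ∫ z : ℝ × ℝ, (z.1 : ℂ) ^ m * (z.2 : ℂ) ^ n *
      Wig1 hbar τ ((WD hbar)^[a] ψ) ((WD hbar)^[b] φ) z) ?_ n 0 0
  · simp only [Function.iterate_zero, id_eq, zero_add, pow_zero, mul_one] at hrec
    rw [hrec]
    refine Finset.sum_congr rfl fun k _ => ?_
    congr 1
    rw [Wig_xm hbar τ hhbar]
    have h := WD_symm_iter hbar k (WX^[m] ((WD hbar)^[n - k] ψ)) φ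
    have e : ⇑(WX^[m] ((WD hbar)^[n - k] ψ)) =
        fun y : ℝ => (y : ℂ) ^ m * (Dop hbar)^[n - k] (⇑ψ) y := by
      ext y
      rw [WX_iter, WD_iter]
    rw [WD_iter hbar k (WX^[m] ((WD hbar)^[n - k] ψ)), e] at h
    rw [← h, WD_iter hbar (n - k)]
  · intro n a b
    have h1 := Wig_int hbar τ hhbar.ne' m n ((WD hbar)^[a + 1] ψ) ((WD hbar)^[b] φ)
    have h2 := Wig_int hbar τ hhbar.ne' m n ((WD hbar)^[a] ψ) ((WD hbar)^[b + 1] φ)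
    rw [← integral_const_mul, ← integral_const_mul,
      ← integral_add (h1.const_mul _) (h2.const_mul _)]
    congr 1
    ext ⟨x, p⟩
    have h3 := Wig_p hbar τ hhbar.ne' ((WD hbar)^[a] ψ) ((WD hbar)^[b] φ) x p
    rw [Function.iterate_succ_apply', Function.iterate_succ_apply']
    linear_combination (x : ℂ) ^ m * (p : ℂ) ^ n * h3
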